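/- Let A ∈ M_d(ℤ) be non-singular and let v ∈ ℚ^d. If the sequence (A^n ω v)_{n≥0} is uniformly distributed modulo 1 for some ω ∈ ℝ, then it is uniformly distributed modulo 1 for Lebesgue-almost every ω ∈ ℝ. -/

import Mathlib

open MeasureTheory Filter Matrix

/-- A sequence in `ℝ^d` is uniformly distributed modulo 1 if the Birkhoff-type averages of
every continuous `ℤ^d`-periodic function converge to its integral over the torus
(realized as the unit cube `[0,1]^d` with Lebesgue measure). -/
def UDMod1 {d : ℕ} (x : ℕ → (Fin d → ℝ)) : Prop :=
  ∀ f : (Fin d → ℝ) → ℂ, Continuous f →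
    (∀ (y : Fin d → ℝ) (k : Fin d → ℤ), f (y + fun i => (k i : ℝ)) = f y) →
    Tendsto (fun N : ℕ => (N : ℂ)⁻¹ • ∑ n ∈ Finset.range N, f (x n)) atTop
      (nhds (∫ y in Set.Icc (0 : Fin d → ℝ) 1, f y))

/-- The `p`-adic size of the Taylor coefficients `p ^ j * c j / j!` tends to zero. -/
lemma padicNorm_pow_mul_div_factorial_le {p : ℕ} [Fact p.Prime] (hp : p ≠ 2) (c : ℤ) (j : ℕ) :
    padicNorm p ((p : ℚ) ^ j * c / (j.factorial : ℚ)) ≤ ((p : ℚ)⁻¹) ^ (j / 2) := by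
  have hpp : p.Prime := Fact.out
  have hp3 : 2 ≤ p - 1 := by have := hpp.two_le; omega
  have hp0 : (p : ℚ) ≠ 0 := by exact_mod_cast hpp.ne_zero
  have hfac : (j.factorial : ℚ) ≠ 0 := by exact_mod_cast j.factorial_ne_zero
  set v := padicValNat p j.factorial with hv
  have h2v : 2 * v ≤ j := by
    have h := sub_one_mul_padicValNat_factorial (p := p) j
    have : 2 * v ≤ (p - 1) * v := Nat.mul_le_mul_right _ hp3
    exact this.trans (h.le.trans (Nat.sub_le _ _))
  have hpow : ∀ n : ℕ, padicNorm p ((p : ℚ) ^ n) = ((p : ℚ)⁻¹) ^ n := by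
    intro n
    induction n with
    | zero => simp
    | succ n ih => rw [pow_succ, padicNorm.mul, ih, padicNorm.padicNorm_p_of_prime, pow_succ]
  have hnf : padicNorm p (j.factorial : ℚ) = ((p : ℚ)⁻¹) ^ v := by
    rw [padicNorm.eq_zpow_of_nonzero hfac, padicValRat.of_nat, _root_.zpow_neg, zpow_natCast, inv_pow]
  rw [padicNorm.div, padicNorm.mul, hpow, hnf]
  have hc : padicNorm p (c : ℚ) ≤ 1 := padicNorm.of_int c
  have hq : 0 < ((p : ℚ)⁻¹) := by have := hpp.pos; positivity
  have hq1 : ((p : ℚ)⁻¹) ≤ 1 := inv_le_one_of_one_le₀ (by exact_mod_cast hpp.one_le)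
  rw [div_le_iff₀ (by positivity), ← pow_add]
  calc ((p : ℚ)⁻¹) ^ j * padicNorm p (c : ℚ) ≤ ((p : ℚ)⁻¹) ^ j * 1 := by gcongr
    _ ≤ _ := by
      rw [mul_one]
      exact pow_le_pow_of_le_one hq.le hq1 (by omega)

/-- A nonzero null sequence indexed by positive integers has a last dominant term. -/
lemma exists_last_dominant {u : ℕ → ℚ} (hu : ∀ ε > 0, ∃ K, ∀ j ≥ K, u j < ε)
    {i : ℕ} (hi : 1 ≤ i) (hi0 : 0 < u i) :
    ∃ J, 1 ≤ J ∧ 0 < u J ∧ ∀ j, J < j → u j < u J := by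
  obtain ⟨K, hK⟩ := hu (u i) hi0
  obtain ⟨m, hm, hmax⟩ := (Finset.Icc 1 (K + i)).exists_max_image u ⟨i, by simp; omega⟩
  set T := (Finset.Icc 1 (K + i)).filter (fun j => u j = u m) with hT
  have hTm : m ∈ T := by simp [hT] at hm ⊢; exact hm
  refine ⟨T.max' ⟨m, hTm⟩, ?_⟩
  have hmem := T.max'_mem ⟨m, hTm⟩
  have hle : ∀ j ∈ T, j ≤ T.max' ⟨m, hTm⟩ := fun j hj => T.le_max' j hj
  generalize T.max' ⟨m, hTm⟩ = J at hmem hle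
  simp only [hT, Finset.mem_filter, Finset.mem_Icc] at hmem hle
  have hiJ : u i ≤ u J := by
    rw [hmem.2]; exact hmax i (by simp; omega)
  refine ⟨hmem.1.1, hi0.trans_le hiJ, fun j hj => ?_⟩
  by_cases hjK : j ≤ K + i
  · have h1 := hmax j (by simp; omega)
    rw [hmem.2]
    refine lt_of_le_of_ne h1 fun h => ?_
    have hjJ : j ≤ J := hle j ⟨⟨by omega, hjK⟩, h⟩
    omega
  · exact (hK j (by omega)).trans_le hiJ

open Polynomial in
/-- A discrete form of Strassmann's theorem: a nonconstant binomial series with coefficients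
`p ^ j * c j` takes each value a uniformly bounded number of times. -/
lemma exists_card_fiber_le_of_binomial_series {p : ℕ} [Fact p.Prime] (hp : p ≠ 2) (c : ℕ → ℤ)
    {i : ℕ} (hi : 1 ≤ i) (hci : c i ≠ 0) :
    ∃ C : ℕ, ∀ (s : Finset ℕ) (a : ℤ),
      (∀ n ∈ s, ∑ j ∈ Finset.range (n + 1), (n.choose j : ℤ) * ((p : ℤ) ^ j * c j) = a) →
      s.card ≤ C := by
  have hpp : p.Prime := Fact.out
  set b : ℕ → ℚ := fun j => (p : ℚ) ^ j * c j / (j.factorial : ℚ) with hb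
  have hsmall : ∀ ε > 0, ∃ K, ∀ j ≥ K, padicNorm p (b j) < ε := by
    intro ε hε
    obtain ⟨K, hK⟩ := exists_pow_lt_of_lt_one hε (y := ((p : ℚ)⁻¹))
      (inv_lt_one_of_one_lt₀ (by exact_mod_cast hpp.one_lt))
    refine ⟨2 * K, fun j hj => (padicNorm_pow_mul_div_factorial_le hp (c j) j).trans_lt ?_⟩
    refine lt_of_le_of_lt (pow_le_pow_of_le_one (by positivity) ?_ (by omega)) hK
    exact inv_le_one_of_one_le₀ (by exact_mod_cast hpp.one_le)
  have hbi : 0 < padicNorm p (b i) := by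
    refine lt_of_le_of_ne (padicNorm.nonneg _) (Ne.symm (padicNorm.nonzero ?_))
    have : (p : ℚ) ≠ 0 := by exact_mod_cast hpp.ne_zero
    have : (c i : ℚ) ≠ 0 := by exact_mod_cast hci
    have := i.factorial_ne_zero
    simp only [hb]
    positivity
  obtain ⟨J, hJ1, hJ0, hJ⟩ := exists_last_dominant (u := fun j => padicNorm p (b j)) hsmall hi hbi
  refine ⟨J, fun s a hs => ?_⟩
  by_contra! hcard
  obtain ⟨t, hts, htc⟩ := Finset.exists_subset_card_eq (Nat.succ_le_of_lt hcard)
  set Q : ℤ[X] := ∏ n ∈ t, (X - C (n : ℤ)) with hQ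
  have hQm : Q.Monic := monic_prod_of_monic _ _ fun n _ => monic_X_sub_C _
  have hQd : Q.natDegree = J + 1 := by
    rw [hQ, natDegree_prod_of_monic _ _ fun n _ => monic_X_sub_C _]
    simp only [natDegree_X_sub_C, Finset.sum_const, smul_eq_mul, mul_one, htc]
  have hQdeg : Q.degree = ((J + 1 : ℕ) : WithBot ℕ) := by
    rw [degree_eq_natDegree hQm.ne_zero, hQd]
  set r : ℕ → ℤ[X] := fun j => descPochhammer ℤ j %ₘ Q with hr
  have hrdeg : ∀ j, (r j).degree < ((J + 1 : ℕ) : WithBot ℕ) := fun j =>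
    hQdeg ▸ degree_modByMonic_lt _ hQm
  have hreval : ∀ j, ∀ n ∈ t, (r j).eval (n : ℤ) = (n.descFactorial j : ℤ) := by
    intro j n hn
    have hroot : Q.IsRoot (n : ℤ) := by
      rw [hQ, IsRoot, eval_prod]
      exact Finset.prod_eq_zero hn (by simp)
    have h := congrArg (eval (n : ℤ)) (modByMonic_add_div (descPochhammer ℤ j) Q)
    rw [eval_add, eval_mul, hroot.eq_zero, zero_mul, add_zero] at h
    rw [hr, h, descPochhammer_eval_eq_descFactorial]
  have hrlow : ∀ j ≤ J, r j = descPochhammer ℤ j := by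
    intro j hj
    refine (modByMonic_eq_self_iff hQm).2 ?_
    rw [hQdeg, degree_eq_natDegree (monic_descPochhammer ℤ j).ne_zero, descPochhammer_natDegree]
    exact_mod_cast Nat.lt_succ_of_le hj
  set K := t.sup id + J with hK
  set R : ℚ[X] := ∑ j ∈ Finset.range (K + 1), C (b j) * (r j).map (Int.castRingHom ℚ) with hR
  have hRdeg : R.degree < (t.card : WithBot ℕ) := by
    rw [htc]
    refine lt_of_le_of_lt (degree_sum_le _ _) ((Finset.sup_lt_iff (WithBot.bot_lt_coe _)).2 ?_)
    intro j _
    exact ((smul_eq_C_mul (b j) (p := (r j).map (Int.castRingHom ℚ))) ▸ degree_smul_le _ _).trans_lt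
      (degree_map_le.trans_lt (hrdeg j))
  have hReval : ∀ n ∈ t, R.eval (n : ℚ) = a := by
    intro n hn
    have hnK : n ≤ K := (Finset.le_sup (f := id) hn).trans (Nat.le_add_right _ _)
    have h1 : R.eval (n : ℚ) = ∑ j ∈ Finset.range (K + 1), (n.choose j : ℚ) * ((p : ℚ) ^ j * c j) := by
      rw [hR, eval_finsetSum]
      refine Finset.sum_congr rfl fun j _ => ?_
      have h2 : eval (n : ℚ) ((r j).map (Int.castRingHom ℚ)) = (n.descFactorial j : ℚ) := by
        have := eval_intCast_map (Int.castRingHom ℚ) (r j) (n : ℤ)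
        simp only [Int.cast_natCast] at this
        rw [this, hreval j n hn]; simp
      rw [eval_mul, eval_C, h2, Nat.descFactorial_eq_factorial_mul_choose]
      have := j.factorial_ne_zero
      simp only [hb]
      push_cast
      field_simp
    rw [h1, ← hs n (hts hn)]
    push_cast
    symm
    refine Finset.sum_subset (by intro x; simp; omega) fun j _ hj => ?_
    rw [Nat.choose_eq_zero_of_lt (by simp at hj; omega)]
    simp
  have hRC : R = C (a : ℚ) := by
    refine eq_of_degrees_lt_of_eval_index_eq t (v := fun n : ℕ => (n : ℚ))
      (fun x _ y _ h => Nat.cast_injective h) hRdeg ?_ ?_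
    · exact degree_C_le.trans_lt (by rw [htc]; exact_mod_cast Nat.succ_pos J)
    · intro n hn; rw [hReval n hn, eval_C]
  have hcoef : ∑ j ∈ Finset.range (K + 1), b j * ((r j).coeff J : ℚ) = 0 := by
    have := congrArg (fun P => coeff P J) hRC
    rw [coeff_C_of_ne_zero (show J ≠ 0 by omega)] at this
    simpa [hR, finsetSum_coeff] using this
  rw [← Finset.add_sum_erase _ _ (show J ∈ Finset.range (K + 1) by simp; omega),
    hrlow J le_rfl] at hcoef
  have hlead : (descPochhammer ℤ J).coeff J = 1 := by
    have := (monic_descPochhammer ℤ J).coeff_natDegree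
    rwa [descPochhammer_natDegree] at this
  rw [hlead, Int.cast_one, mul_one] at hcoef
  have hlt : padicNorm p (∑ j ∈ (Finset.range (K + 1)).erase J, b j * ((r j).coeff J : ℚ))
      < padicNorm p (b J) := by
    refine padicNorm.sum_lt' (fun j hj => ?_) hJ0
    rcases lt_or_gt_of_ne (Finset.ne_of_mem_erase hj) with h | h
    · rw [hrlow j h.le, coeff_eq_zero_of_natDegree_lt (by rwa [descPochhammer_natDegree])]
      simpa using hJ0
    · rw [padicNorm.mul]
      exact (mul_le_of_le_one_right (padicNorm.nonneg _) (padicNorm.of_int _)).trans_lt (hJ j h)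
  rw [eq_neg_of_add_eq_zero_left hcoef, padicNorm.neg] at hlt
  exact lt_irrefl _ hlt

/-- Some power of a nonsingular integer matrix is congruent to the identity modulo a prime. -/
lemma exists_pow_eq_one_add_smul {d : ℕ} (A : Matrix (Fin d) (Fin d) ℤ) (hA : A.det ≠ 0) :
    ∃ p : ℕ, p.Prime ∧ p ≠ 2 ∧ ∃ M : ℕ, 0 < M ∧ ∃ B : Matrix (Fin d) (Fin d) ℤ,
      A ^ M = (p : ℤ) • B + 1 := by
  obtain ⟨p, hpge, hp⟩ := Nat.exists_infinite_primes (A.det.natAbs + 3)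
  have : Fact p.Prime := ⟨hp⟩
  refine ⟨p, hp, by omega, ?_⟩
  set φ := Int.castRingHom (ZMod p)
  have hunit : IsUnit (φ.mapMatrix A) := by
    rw [Matrix.isUnit_iff_isUnit_det, ← RingHom.map_det, isUnit_iff_ne_zero]
    simp only [φ, eq_intCast, ne_eq, ZMod.intCast_zmod_eq_zero_iff_dvd]
    intro h
    have := Nat.le_of_dvd (Int.natAbs_pos.2 hA) (Int.natCast_dvd.1 h)
    omega
  obtain ⟨u, hu⟩ := hunit
  obtain ⟨M, hM, hM1⟩ := (isOfFinOrder_of_finite u).exists_pow_eq_one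
  refine ⟨M, hM, ?_⟩
  have hmap : φ.mapMatrix (A ^ M - 1) = 0 := by
    rw [map_sub, map_pow, ← hu, ← Units.val_pow_eq_pow_val, hM1]; simp
  have hdvd : ∀ i j, (p : ℤ) ∣ (A ^ M - 1) i j := by
    intro i j
    rw [← ZMod.intCast_zmod_eq_zero_iff_dvd]
    exact congrFun (congrFun hmap i) j
  choose B hB using hdvd
  refine ⟨Matrix.of B, ?_⟩
  rw [← sub_eq_iff_eq_add]
  ext i j
  simp [hB i j]

/-- The binomial expansion along a residue class of a linear recurrence sequence. -/
lemma dotProduct_pow_mulVec_eq_sum {d : ℕ} {A B : Matrix (Fin d) (Fin d) ℤ} {M : ℕ} {p : ℤ}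
    (h : A ^ M = p • B + 1) (k w : Fin d → ℤ) (r n : ℕ) :
    k ⬝ᵥ (A ^ (r + M * n) *ᵥ w) =
      ∑ j ∈ Finset.range (n + 1), (n.choose j : ℤ) * (p ^ j * (k ⬝ᵥ ((A ^ r * B ^ j) *ᵥ w))) := by
  rw [pow_add, pow_mul, h, (Commute.one_right _).add_pow, Finset.mul_sum, Matrix.sum_mulVec,
    dotProduct_sum]
  refine Finset.sum_congr rfl fun j _ => ?_
  rw [one_pow, mul_one, smul_pow, ← nsmul_eq_mul', mul_smul_comm, mul_smul_comm,
    smul_mulVec, smul_mulVec, dotProduct_smul, dotProduct_smul]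
  simp

/-- A linear recurrence sequence of a nonsingular integer matrix which is not constant
along any arithmetic progression takes each value a uniformly bounded number of times. -/
lemma exists_card_fiber_le {d : ℕ} (A : Matrix (Fin d) (Fin d) ℤ) (hA : A.det ≠ 0)
    (k w : Fin d → ℤ)
    (hne : ∀ M r : ℕ, 0 < M →
      ∃ n, k ⬝ᵥ (A ^ (r + M * n) *ᵥ w) ≠ k ⬝ᵥ (A ^ r *ᵥ w)) :
    ∃ C : ℕ, ∀ (s : Finset ℕ) (a : ℤ), (∀ n ∈ s, k ⬝ᵥ (A ^ n *ᵥ w) = a) → s.card ≤ C := by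
  obtain ⟨p, hp, hp2, M, hM, B, hB⟩ := exists_pow_eq_one_add_smul A hA
  have : Fact p.Prime := ⟨hp⟩
  have hres : ∀ r : ℕ, ∃ C : ℕ, ∀ (s : Finset ℕ) (a : ℤ),
      (∀ n ∈ s, k ⬝ᵥ (A ^ (r + M * n) *ᵥ w) = a) → s.card ≤ C := by
    intro r
    have hi : ∃ i, 1 ≤ i ∧ k ⬝ᵥ ((A ^ r * B ^ i) *ᵥ w) ≠ 0 := by
      by_contra! hzero
      obtain ⟨n, hn⟩ := hne M r hM
      refine hn ?_
      rw [dotProduct_pow_mulVec_eq_sum hB, Finset.sum_range_succ', Finset.sum_eq_zero]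
      · simp
      · intro j _
        rw [hzero (j + 1) (by omega)]; simp
    obtain ⟨i, hi, hi0⟩ := hi
    simp_rw [dotProduct_pow_mulVec_eq_sum hB]
    exact exists_card_fiber_le_of_binomial_series hp2 _ hi hi0
  choose C hC using hres
  refine ⟨∑ r ∈ Finset.range M, C r, fun s a hs => ?_⟩
  rw [Finset.card_eq_sum_card_fiberwise (f := (· % M)) (t := Finset.range M)
    (fun n _ => by simpa using Nat.mod_lt n hM)]
  refine Finset.sum_le_sum fun r _ => ?_
  rw [← Finset.card_image_of_injOn (f := (· / M))]
  · refine hC r _ a fun m hm => ?_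
    obtain ⟨n, hn, rfl⟩ := Finset.mem_image.1 hm
    obtain ⟨hns, rfl⟩ := Finset.mem_filter.1 hn
    rw [Nat.mod_add_div]
    exact hs n hns
  · intro x hx y hy hxy
    simp only [Finset.coe_filter, Set.mem_ofPred_eq] at hx hy hxy
    rw [← Nat.mod_add_div x M, ← Nat.mod_add_div y M, hx.2, hy.2, hxy]

/-- The character `t ↦ exp (2πit)` of `ℝ / ℤ`. -/
noncomputable def unitExp (t : ℝ) : ℂ := Complex.exp ((2 * Real.pi * t : ℝ) * Complex.I)

lemma unitExp_zero : unitExp 0 = 1 := by simp [unitExp]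

lemma unitExp_add (s t : ℝ) : unitExp (s + t) = unitExp s * unitExp t := by
  rw [unitExp, unitExp, unitExp, ← Complex.exp_add]
  push_cast
  ring_nf

lemma norm_unitExp (t : ℝ) : ‖unitExp t‖ = 1 := Complex.norm_exp_ofReal_mul_I _

lemma conj_unitExp (t : ℝ) : starRingEnd ℂ (unitExp t) = unitExp (-t) := by
  rw [unitExp, unitExp, ← Complex.exp_conj, map_mul, Complex.conj_ofReal, Complex.conj_I]
  push_cast
  ring_nf

@[fun_prop]
lemma continuous_unitExp : Continuous unitExp := by
  unfold unitExp
  fun_prop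

lemma unitExp_intCast (n : ℤ) : unitExp n = 1 := by
  rw [unitExp, ← Complex.exp_int_mul_two_pi_mul_I n]
  push_cast
  ring_nf

lemma unitExp_sum {ι : Type*} (s : Finset ι) (f : ι → ℝ) :
    unitExp (∑ i ∈ s, f i) = ∏ i ∈ s, unitExp (f i) := by
  classical
  induction s using Finset.induction_on with
  | empty => simp [unitExp_zero]
  | insert a s ha ih => rw [Finset.sum_insert ha, Finset.prod_insert ha, unitExp_add, ih]

lemma integral_unitExp_mul_intCast (l : ℤ) (a : ℝ) :
    ∫ θ in a..a + 1, unitExp (θ * l) = if l = 0 then 1 else 0 := by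
  split_ifs with hl
  · simp [hl, unitExp_zero]
  · have hc : (2 * Real.pi * l * Complex.I : ℂ) ≠ 0 := by
      have : (l : ℂ) ≠ 0 := by exact_mod_cast hl
      simp [this, Real.pi_ne_zero]
    have h : ∀ θ : ℝ, unitExp (θ * l) = Complex.exp (2 * Real.pi * l * Complex.I * θ) := by
      intro θ
      rw [unitExp]
      push_cast
      ring_nf
    simp_rw [h]
    rw [integral_exp_mul_complex hc, ← h, ← h, add_mul, one_mul, unitExp_add, unitExp_intCast]
    simp

lemma norm_sum_unitExp_sq {ι : Type*} (s : Finset ι) (x : ι → ℝ) :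
    ((‖∑ i ∈ s, unitExp (x i)‖ ^ 2 : ℝ) : ℂ) = ∑ i ∈ s, ∑ j ∈ s, unitExp (x i - x j) := by
  push_cast
  rw [← Complex.mul_conj', map_sum, Finset.sum_mul_sum]
  simp_rw [conj_unitExp, ← unitExp_add, sub_eq_add_neg]

/-- The mean square of an exponential sum over integer frequencies of bounded multiplicity. -/
lemma integral_norm_sum_unitExp_sq_le {a : ℕ → ℤ} {C : ℕ}
    (hC : ∀ (s : Finset ℕ) (c : ℤ), (∀ n ∈ s, a n = c) → s.card ≤ C) (N : ℕ) (m : ℝ) :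
    ∫ θ in m..m + 1, ‖∑ n ∈ Finset.range N, unitExp (θ * a n)‖ ^ 2 ≤ C * N := by
  have h : ((∫ θ in m..m + 1, ‖∑ n ∈ Finset.range N, unitExp (θ * a n)‖ ^ 2 : ℝ) : ℂ) =
      ((∑ i ∈ Finset.range N, ((Finset.range N).filter fun j => a j = a i).card : ℕ) : ℂ) := by
    rw [← intervalIntegral.integral_ofReal]
    simp_rw [norm_sum_unitExp_sq, ← mul_sub, ← Int.cast_sub]
    rw [intervalIntegral.integral_finsetSum
      fun i _ => (by fun_prop : Continuous _).intervalIntegrable _ _]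
    rw [Nat.cast_sum]
    refine Finset.sum_congr rfl fun i _ => ?_
    rw [intervalIntegral.integral_finsetSum
      fun i _ => (by fun_prop : Continuous _).intervalIntegrable _ _]
    simp_rw [integral_unitExp_mul_intCast, sub_eq_zero]
    simp [eq_comm]
  have h' : ∫ θ in m..m + 1, ‖∑ n ∈ Finset.range N, unitExp (θ * a n)‖ ^ 2 =
      ((∑ i ∈ Finset.range N, ((Finset.range N).filter fun j => a j = a i).card : ℕ) : ℝ) := by
    exact_mod_cast h
  rw [h']
  have hle : ∑ i ∈ Finset.range N, ((Finset.range N).filter fun j => a j = a i).card ≤ N * C := by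
    refine (Finset.sum_le_card_nsmul _ _ C fun i _ => hC _ (a i) fun n hn => ?_).trans (by simp)
    exact (Finset.mem_filter.1 hn).2
  rw [mul_comm]
  exact_mod_cast hle

/-- Cesàro means of a bounded sequence converge to zero as soon as they do along the squares. -/
lemma tendsto_norm_sum_div_of_sq {z : ℕ → ℂ} (hz : ∀ n, ‖z n‖ ≤ 1)
    (h : Tendsto (fun j : ℕ => ‖∑ n ∈ Finset.range (j ^ 2), z n‖ / (j : ℝ) ^ 2) atTop (nhds 0)) :
    Tendsto (fun N : ℕ => ‖∑ n ∈ Finset.range N, z n‖ / (N : ℝ)) atTop (nhds 0) := by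
  have hsqrt : Tendsto Nat.sqrt atTop atTop :=
    tendsto_atTop_atTop.2 fun b => ⟨b ^ 2, fun n hn => Nat.le_sqrt'.2 hn⟩
  have hg : Tendsto (fun j : ℕ => ‖∑ n ∈ Finset.range (j ^ 2), z n‖ / (j : ℝ) ^ 2 + 2 / (j : ℝ))
      atTop (nhds 0) := by
    simpa using h.add (tendsto_const_div_atTop_nhds_zero_nat (2 : ℝ))
  refine squeeze_zero (fun _ => by positivity) (fun N => ?_) (hg.comp hsqrt)
  simp only [Function.comp]
  have hlow : N.sqrt ^ 2 ≤ N := Nat.sqrt_le' N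
  have hupp : N ≤ N.sqrt ^ 2 + 2 * N.sqrt := by
    have := Nat.sqrt_le_add N
    rw [pow_two]; omega
  generalize N.sqrt = s at hlow hupp
  rcases Nat.eq_zero_or_pos s with rfl | hs
  · obtain rfl : N = 0 := by omega
    simp
  have hsum : ‖∑ n ∈ Finset.range N, z n‖ ≤ ‖∑ n ∈ Finset.range (s ^ 2), z n‖ + 2 * s := by
    rw [← Finset.sum_range_add_sum_Ico _ hlow]
    refine (norm_add_le _ _).trans (add_le_add le_rfl ?_)
    refine (norm_sum_le_of_le _ fun n _ => hz n).trans ?_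
    simp only [Finset.sum_const, Nat.card_Ico, nsmul_eq_mul, mul_one]
    exact_mod_cast (by omega : N - s ^ 2 ≤ 2 * s)
  have hs' : (0 : ℝ) < s := by exact_mod_cast hs
  calc ‖∑ n ∈ Finset.range N, z n‖ / (N : ℝ)
      ≤ (‖∑ n ∈ Finset.range (s ^ 2), z n‖ + 2 * s) / (s : ℝ) ^ 2 := by
        gcongr
        exact_mod_cast hlow
    _ = _ := by field_simp

/-- If an integer sequence takes each value a bounded number of times, its dilates by almost every
real number have vanishing exponential means. -/
lemma ae_tendsto_norm_sum_unitExp_div {a : ℕ → ℤ} {C : ℕ}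
    (hC : ∀ (s : Finset ℕ) (c : ℤ), (∀ n ∈ s, a n = c) → s.card ≤ C) :
    ∀ᵐ θ ∂(volume : Measure ℝ),
      Tendsto (fun N : ℕ => ‖∑ n ∈ Finset.range N, unitExp (θ * a n)‖ / (N : ℝ)) atTop
        (nhds 0) := by
  rw [← Measure.restrict_univ (μ := (volume : Measure ℝ)), ← iUnion_Ioc_intCast (α := ℝ),
    ae_restrict_iUnion_iff]
  intro m
  set F : ℕ → ℝ → ℝ := fun j θ =>
    (‖∑ n ∈ Finset.range (j ^ 2), unitExp (θ * a n)‖ / (j : ℝ) ^ 2) ^ 2 with hF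
  have hFc : ∀ j, Continuous (F j) := fun j => by simp only [hF]; fun_prop
  have hFint : ∀ j, ∫⁻ θ in Set.Ioc (m : ℝ) (m + 1), ENNReal.ofReal (F j θ) ≤
      ENNReal.ofReal (C * ((j : ℝ) ^ 2)⁻¹) := by
    intro j
    rw [← ofReal_integral_eq_lintegral_ofReal
      ((hFc j).integrableOn_Ioc) (Eventually.of_forall fun θ => by positivity),
      ← intervalIntegral.integral_of_le (by linarith)]
    refine ENNReal.ofReal_le_ofReal ?_
    simp only [hF, div_pow]
    rw [intervalIntegral.integral_div]
    rcases Nat.eq_zero_or_pos j with rfl | hj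
    · simp
    have hj' : (0 : ℝ) < j := by exact_mod_cast hj
    rw [div_le_iff₀ (by positivity)]
    refine (integral_norm_sum_unitExp_sq_le hC (j ^ 2) m).trans (le_of_eq ?_)
    push_cast
    field_simp
  have hsum : ∫⁻ θ in Set.Ioc (m : ℝ) (m + 1), ∑' j, ENNReal.ofReal (F j θ) ≠ ⊤ := by
    rw [lintegral_tsum fun j => (hFc j).measurable.ennreal_ofReal.aemeasurable]
    refine ne_top_of_le_ne_top ?_ (ENNReal.tsum_le_tsum hFint)
    exact ((Real.summable_nat_pow_inv.2 one_lt_two).mul_left (C : ℝ)).tsum_ofReal_ne_top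
  filter_upwards [ae_lt_top' (AEMeasurable.tsum
    fun j => (hFc j).measurable.ennreal_ofReal.aemeasurable) hsum] with θ hθ
  refine tendsto_norm_sum_div_of_sq (fun n => (norm_unitExp _).le) ?_
  have h1 := ENNReal.tendsto_atTop_zero_of_tsum_ne_top hθ.ne
  have h2 : Tendsto (fun j => F j θ) atTop (nhds 0) := by
    have := (ENNReal.tendsto_toReal ENNReal.zero_ne_top).comp h1
    refine this.congr fun j => ENNReal.toReal_ofReal (by positivity)
  have h3 := h2.sqrt
  rw [Real.sqrt_zero] at h3
  exact h3.congr fun j => Real.sqrt_sq (by positivity)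

/-- A real sequence whose nonzero integer multiples have vanishing exponential means is not
constant along an arithmetic progression. -/
lemma exists_ne_of_tendsto_norm_sum_unitExp_div {t : ℕ → ℝ}
    (ht : ∀ l : ℤ, l ≠ 0 → Tendsto
      (fun N : ℕ => ‖∑ n ∈ Finset.range N, unitExp (l * t n)‖ / (N : ℝ)) atTop (nhds 0))
    {M : ℕ} (hM : 0 < M) (r : ℕ) : ∃ n, t (r + M * n) ≠ t r := by
  by_contra! hconst
  set G : ℕ → ℝ := fun n => ‖∑ j ∈ Finset.range (M + 1), unitExp (j * (t n - t r))‖ ^ 2 with hG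
  set b : ℕ → ℝ := fun N => ∑ i ∈ Finset.range (M + 1), ∑ j ∈ Finset.range (M + 1),
    ‖∑ n ∈ Finset.range N, unitExp (((i - j : ℤ) : ℝ) * t n)‖ / (N : ℝ) with hb
  have hupper : ∀ N : ℕ, 0 < N → ∑ n ∈ Finset.range N, G n ≤ b N * N := by
    intro N hN
    have hN' : (N : ℝ) ≠ 0 := by exact_mod_cast hN.ne'
    have h : ((∑ n ∈ Finset.range N, G n : ℝ) : ℂ) = ∑ i ∈ Finset.range (M + 1),
        ∑ j ∈ Finset.range (M + 1), unitExp (-((i - j : ℤ) : ℝ) * t r) *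
          ∑ n ∈ Finset.range N, unitExp (((i - j : ℤ) : ℝ) * t n) := by
      rw [Complex.ofReal_sum]
      simp_rw [hG, norm_sum_unitExp_sq, Finset.mul_sum, ← unitExp_add]
      rw [Finset.sum_comm]
      refine Finset.sum_congr rfl fun i _ => ?_
      rw [Finset.sum_comm]
      refine Finset.sum_congr rfl fun j _ => Finset.sum_congr rfl fun n _ => ?_
      congr 1
      push_cast
      ring
    calc ∑ n ∈ Finset.range N, G n ≤ ‖((∑ n ∈ Finset.range N, G n : ℝ) : ℂ)‖ := by
          rw [Complex.norm_real]; exact le_abs_self _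
      _ ≤ ∑ i ∈ Finset.range (M + 1), ∑ j ∈ Finset.range (M + 1),
          ‖∑ n ∈ Finset.range N, unitExp (((i - j : ℤ) : ℝ) * t n)‖ := by
        rw [h]
        refine norm_sum_le_of_le _ fun i _ => norm_sum_le_of_le _ fun j _ => ?_
        rw [norm_mul, norm_unitExp, one_mul]
      _ = b N * N := by
        simp_rw [hb, ← Finset.sum_div]
        field_simp
  have hlower : ∀ L : ℕ, (L : ℝ) * (M + 1) ^ 2 ≤ ∑ n ∈ Finset.range (r + M * L), G n := by
    intro L
    have hinj : Function.Injective fun n : ℕ => r + M * n := fun x y h => by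
      simpa [hM.ne'] using h
    have hsub : (Finset.range L).image (fun n => r + M * n) ⊆ Finset.range (r + M * L) := by
      intro n hn
      obtain ⟨m, hm, rfl⟩ := Finset.mem_image.1 hn
      have := Nat.mul_lt_mul_of_pos_left (Finset.mem_range.1 hm) hM
      simp only [Finset.mem_range]
      omega
    refine le_trans (le_of_eq ?_)
      (Finset.sum_le_sum_of_subset_of_nonneg hsub fun n _ _ => by positivity)
    rw [Finset.sum_image hinj.injOn]
    simp only [hG, hconst, sub_self, mul_zero, unitExp_zero, Finset.sum_const, Finset.card_range,
      nsmul_eq_mul, mul_one, Complex.norm_natCast]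
    push_cast
    ring
  have hlim : Tendsto b atTop (nhds (∑ i ∈ Finset.range (M + 1), ∑ j ∈ Finset.range (M + 1),
      if i = j then 1 else 0)) := by
    refine tendsto_finsetSum _ fun i _ => tendsto_finsetSum _ fun j _ => ?_
    split_ifs with hij
    · refine tendsto_const_nhds.congr' ?_
      filter_upwards [eventually_gt_atTop 0] with N hN
      have hN' : (N : ℝ) ≠ 0 := by exact_mod_cast hN.ne'
      simp [hij, unitExp_zero, hN']
    · exact ht _ (by rw [sub_ne_zero]; exact_mod_cast hij)
  have hval : ∑ i ∈ Finset.range (M + 1), ∑ j ∈ Finset.range (M + 1),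
      (if i = j then (1 : ℝ) else 0) = M + 1 := by
    rw [Finset.sum_congr rfl fun i hi => by rw [Finset.sum_ite_eq, if_pos hi]]
    simp
  rw [hval] at hlim
  obtain ⟨N₀, hN₀⟩ := eventually_atTop.1
    (hlim.eventually (gt_mem_nhds (show (M : ℝ) + 1 < M + 3 / 2 by linarith)))
  set L := N₀ + 2 * r + 1 with hL
  have hNL : L ≤ r + M * L := by nlinarith
  have h1 := hlower L
  have h2 := hupper (r + M * L) (by omega)
  have h3 := hN₀ (r + M * L) (by omega)
  have h4 : b (r + M * L) * ((r + M * L : ℕ) : ℝ) ≤ (M + 3 / 2) * ((r + M * L : ℕ) : ℝ) := by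
    gcongr
  have h5 := (h1.trans h2).trans h4
  have hL' : (2 * r + 1 : ℝ) ≤ L := by exact_mod_cast (by omega : 2 * r + 1 ≤ L)
  push_cast at h5
  have hM' : (0 : ℝ) < M := by exact_mod_cast hM
  have hr : (0 : ℝ) ≤ r := by positivity
  nlinarith [mul_le_mul_of_nonneg_left hL' (by positivity : (0 : ℝ) ≤ M / 2 + 1)]

lemma integral_Icc_unitExp_eq_zero {d : ℕ} {k : Fin d → ℤ} (hk : k ≠ 0) :
    ∫ y in Set.Icc (0 : Fin d → ℝ) 1, unitExp (∑ i, (k i : ℝ) * y i) = 0 := by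
  have hIcc : Set.Icc (0 : Fin d → ℝ) 1 = Set.univ.pi fun _ => Set.Icc (0 : ℝ) 1 := by
    rw [← Set.pi_univ_Icc]; rfl
  rw [hIcc, volume_pi, Measure.restrict_pi_pi]
  simp_rw [unitExp_sum]
  rw [integral_fintype_prod_eq_prod (fun i (y : ℝ) => unitExp ((k i : ℝ) * y))]
  obtain ⟨i, hi⟩ := Function.ne_iff.1 hk
  refine Finset.prod_eq_zero (Finset.mem_univ i) ?_
  rw [integral_Icc_eq_integral_Ioc, ← intervalIntegral.integral_of_le zero_le_one]
  have := integral_unitExp_mul_intCast (k i) 0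
  rw [if_neg (by simpa using hi), zero_add] at this
  simpa [mul_comm] using this

lemma UDMod1.tendsto_norm_sum_unitExp_div {d : ℕ} {x : ℕ → Fin d → ℝ} (hx : UDMod1 x)
    {k : Fin d → ℤ} (hk : k ≠ 0) :
    Tendsto (fun N : ℕ => ‖∑ n ∈ Finset.range N, unitExp (∑ i, (k i : ℝ) * x n i)‖ / (N : ℝ))
      atTop (nhds 0) := by
  have h := hx (fun y => unitExp (∑ i, (k i : ℝ) * y i)) (by fun_prop) fun y m => by
    have : ∑ i, (k i : ℝ) * (y + fun i => (m i : ℝ)) i =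
        ∑ i, (k i : ℝ) * y i + ((∑ i, k i * m i : ℤ) : ℝ) := by
      push_cast
      rw [← Finset.sum_add_distrib]
      exact Finset.sum_congr rfl fun i _ => by simp [mul_add]
    simp only [this]
    rw [unitExp_add, unitExp_intCast, mul_one]
  rw [integral_Icc_unitExp_eq_zero hk] at h
  refine (tendsto_zero_iff_norm_tendsto_zero.1 h).congr fun N => ?_
  rw [smul_eq_mul, norm_mul, norm_inv, Complex.norm_natCast, inv_mul_eq_div]

lemma mFourier_coe_eq_unitExp {d : ℕ} (k : Fin d → ℤ) (y : Fin d → ℝ) :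
    UnitAddTorus.mFourier k (fun i => (y i : UnitAddCircle)) =
      unitExp (∑ i, (k i : ℝ) * y i) := by
  rw [unitExp_sum]
  simp only [UnitAddTorus.mFourier, ContinuousMap.coe_mk]
  refine Finset.prod_congr rfl fun i _ => ?_
  rw [fourier_coe_apply, unitExp]
  push_cast
  ring_nf

lemma volume_real_Icc_zero_one (d : ℕ) :
    (volume : Measure (Fin d → ℝ)).real (Set.Icc 0 1) = 1 := by
  simp [Measure.real, Real.volume_Icc_pi]

/-- Averages of trigonometric polynomials converge under Weyl's condition. -/
lemma tendsto_mean_of_mem_span_mFourier {d : ℕ} {x : ℕ → Fin d → ℝ}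
    (hx : ∀ k : Fin d → ℤ, k ≠ 0 → Tendsto
      (fun N : ℕ => ‖∑ n ∈ Finset.range N, unitExp (∑ i, (k i : ℝ) * x n i)‖ / (N : ℝ))
      atTop (nhds 0))
    {g : C(UnitAddTorus (Fin d), ℂ)}
    (hg : g ∈ Submodule.span ℂ (Set.range (UnitAddTorus.mFourier (d := Fin d)))) :
    Tendsto (fun N : ℕ => (N : ℂ)⁻¹ • ∑ n ∈ Finset.range N, g fun i => (x n i : UnitAddCircle))
      atTop (nhds (∫ y in Set.Icc (0 : Fin d → ℝ) 1, g fun i => (y i : UnitAddCircle))) := by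
  have hcont : ∀ g : C(UnitAddTorus (Fin d), ℂ),
      Continuous fun y : Fin d → ℝ => g fun i => (y i : UnitAddCircle) := fun g =>
    g.continuous.comp (continuous_pi fun i =>
      (AddCircle.continuous_mk' 1).comp (continuous_apply i))
  induction hg using Submodule.span_induction with
  | mem g hg =>
    obtain ⟨k, rfl⟩ := hg
    simp_rw [mFourier_coe_eq_unitExp]
    by_cases hk : k = 0
    · simp only [hk, Pi.zero_apply, Int.cast_zero, zero_mul, Finset.sum_const_zero, unitExp_zero,
        integral_const, measureReal_restrict_apply_univ, volume_real_Icc_zero_one, one_smul]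
      refine tendsto_const_nhds.congr' ?_
      filter_upwards [eventually_gt_atTop 0] with N hN
      have hN' : (N : ℂ) ≠ 0 := by exact_mod_cast hN.ne'
      simp [hN']
    · rw [integral_Icc_unitExp_eq_zero hk, tendsto_zero_iff_norm_tendsto_zero]
      refine (hx k hk).congr fun N => ?_
      rw [smul_eq_mul, norm_mul, norm_inv, Complex.norm_natCast, inv_mul_eq_div]
  | zero => simp
  | add g h _ _ ihg ihh =>
    simp only [ContinuousMap.add_apply, Finset.sum_add_distrib, smul_add]
    rw [integral_add (hcont g).integrableOn_Icc (hcont h).integrableOn_Icc]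
    exact ihg.add ihh
  | smul c g _ ih =>
    simp only [ContinuousMap.smul_apply, ← Finset.smul_sum]
    rw [integral_smul]
    exact (ih.const_smul c).congr fun N => smul_comm _ _ _

/-- The sufficiency part of Weyl's criterion. -/
lemma UDMod1.of_tendsto_norm_sum_unitExp_div {d : ℕ} {x : ℕ → Fin d → ℝ}
    (hx : ∀ k : Fin d → ℤ, k ≠ 0 → Tendsto
      (fun N : ℕ => ‖∑ n ∈ Finset.range N, unitExp (∑ i, (k i : ℝ) * x n i)‖ / (N : ℝ))
      atTop (nhds 0)) : UDMod1 x := by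
  intro f hf hper
  set q : (Fin d → ℝ) → UnitAddTorus (Fin d) := Pi.map fun _ => ((↑) : ℝ → UnitAddCircle) with hq
  have hqq : IsOpenQuotientMap q := .piMap fun _ => QuotientAddGroup.isOpenQuotientMap_mk
  have hqc : Topology.IsQuotientMap (⟨q, hqq.continuous⟩ : C(Fin d → ℝ, UnitAddTorus (Fin d))) :=
    hqq.isQuotientMap
  have hfac : Function.FactorsThrough f q := by
    intro y z hyz
    have h : ∀ i, ∃ m : ℤ, y i = z i + m := by
      intro i
      obtain ⟨m, hm⟩ := AddSubgroup.mem_zmultiples_iff.1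
        (QuotientAddGroup.eq_iff_sub_mem.1 (congrFun hyz i))
      exact ⟨m, by rw [← sub_eq_iff_eq_add', ← hm]; simp⟩
    choose m hm using h
    rw [← hper z m]
    exact congrArg f (funext hm)
  set g : C(UnitAddTorus (Fin d), ℂ) := hqc.lift ⟨f, hf⟩ hfac with hg
  have hgq : ∀ y, g (q y) = f y := fun y =>
    congrArg (fun F : C(Fin d → ℝ, ℂ) => F y) (hqc.lift_comp ⟨f, hf⟩ hfac)
  have hmem : g ∈ closure
      (Submodule.span ℂ (Set.range (UnitAddTorus.mFourier (d := Fin d))) : Set _) := by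
    have := UnitAddTorus.span_mFourier_closure_eq_top (d := Fin d)
    rw [← Submodule.topologicalClosure_coe, this]
    trivial
  rw [Metric.tendsto_atTop]
  intro ε hε
  obtain ⟨h, hh, hgh⟩ := Metric.mem_closure_iff.1 hmem (ε / 4) (by positivity)
  obtain ⟨N₀, hN₀⟩ := Metric.tendsto_atTop.1 (tendsto_mean_of_mem_span_mFourier hx hh) (ε / 4)
    (by positivity)
  have hclose : ∀ y, ‖f y - h (q y)‖ ≤ ε / 4 := fun y => by
    rw [← hgq, ← dist_eq_norm]
    exact (ContinuousMap.dist_apply_le_dist _).trans hgh.le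
  have hhc : Continuous fun y => h (q y) := h.continuous.comp hqq.continuous
  refine ⟨N₀, fun N hN => ?_⟩
  have h1 : dist ((N : ℂ)⁻¹ • ∑ n ∈ Finset.range N, f (x n))
      ((N : ℂ)⁻¹ • ∑ n ∈ Finset.range N, h (q (x n))) ≤ ε / 4 := by
    rw [dist_eq_norm, ← smul_sub, ← Finset.sum_sub_distrib, norm_smul, norm_inv,
      Complex.norm_natCast]
    refine (mul_le_mul_of_nonneg_left
      (norm_sum_le_of_le _ fun n _ => hclose (x n)) (by positivity)).trans ?_
    rw [Finset.sum_const, Finset.card_range, nsmul_eq_mul, ← mul_assoc]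
    exact mul_le_of_le_one_left (by positivity) inv_mul_le_one
  have h2 := hN₀ N hN
  have h3 : dist (∫ y in Set.Icc (0 : Fin d → ℝ) 1, h (q y))
      (∫ y in Set.Icc (0 : Fin d → ℝ) 1, f y) ≤ ε / 4 := by
    rw [dist_comm, dist_eq_norm, ← integral_sub hf.integrableOn_Icc hhc.integrableOn_Icc]
    refine (norm_setIntegral_le_of_norm_le_const isCompact_Icc.measure_lt_top
      fun y _ => hclose y).trans ?_
    rw [volume_real_Icc_zero_one, mul_one]
  have h4 := dist_triangle4 ((N : ℂ)⁻¹ • ∑ n ∈ Finset.range N, f (x n))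
      ((N : ℂ)⁻¹ • ∑ n ∈ Finset.range N, h (q (x n)))
      (∫ y in Set.Icc (0 : Fin d → ℝ) 1, h (q y)) (∫ y in Set.Icc (0 : Fin d → ℝ) 1, f y)
  have h2' : dist ((N : ℂ)⁻¹ • ∑ n ∈ Finset.range N, h (q (x n)))
      (∫ y in Set.Icc (0 : Fin d → ℝ) 1, h (q y)) < ε / 4 := h2
  linarith

lemma exists_natCast_mul_eq_intCast {d : ℕ} (v : Fin d → ℚ) :
    ∃ q : ℕ, 0 < q ∧ ∃ w : Fin d → ℤ, ∀ i, (v i : ℝ) = (q : ℝ)⁻¹ * w i := by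
  refine ⟨∏ i, (v i).den, Finset.prod_pos fun i _ => (v i).pos, ?_⟩
  have h : ∀ i, ∃ m : ℤ, (v i : ℝ) = ((∏ i, (v i).den : ℕ) : ℝ)⁻¹ * m := by
    intro i
    refine ⟨(v i).num * ∏ j ∈ Finset.univ.erase i, ((v j).den : ℤ), ?_⟩
    rw [← Finset.mul_prod_erase _ _ (Finset.mem_univ i)]
    have h1 : ((v i).den : ℝ) ≠ 0 := by exact_mod_cast (v i).den_ne_zero
    have h2 : (∏ j ∈ Finset.univ.erase i, ((v j).den : ℝ)) ≠ 0 :=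
      Finset.prod_ne_zero_iff.2 fun j _ => by exact_mod_cast (v j).den_ne_zero
    rw [Rat.cast_def]
    push_cast
    field_simp
  choose w hw using h
  exact ⟨w, hw⟩

lemma sum_mul_pow_mulVec_eq {d : ℕ} (A : Matrix (Fin d) (Fin d) ℤ) (k w : Fin d → ℤ)
    {v : Fin d → ℚ} {q : ℕ} (hv : ∀ i, (v i : ℝ) = (q : ℝ)⁻¹ * w i) (ω : ℝ) (n : ℕ) :
    ∑ i, (k i : ℝ) * (((A.map (Int.cast : ℤ → ℝ)) ^ n) *ᵥ (ω • fun i => ((v i : ℝ)))) i =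
      ω * (q : ℝ)⁻¹ * ((k ⬝ᵥ (A ^ n *ᵥ w) : ℤ) : ℝ) := by
  have hpow : A.map (Int.cast : ℤ → ℝ) ^ n = (A ^ n).map (Int.cast : ℤ → ℝ) :=
    (map_pow (Int.castRingHom ℝ).mapMatrix A n).symm
  rw [hpow]
  simp only [dotProduct, mulVec, Matrix.map_apply, Pi.smul_apply, smul_eq_mul, hv]
  push_cast
  simp only [Finset.mul_sum]
  exact Finset.sum_congr rfl fun i _ => Finset.sum_congr rfl fun j _ => by ring

lemma quasiMeasurePreserving_mul_right {c : ℝ} (hc : c ≠ 0) :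
    Measure.QuasiMeasurePreserving (fun x : ℝ => x * c) volume volume := by
  refine ⟨by fun_prop, ?_⟩
  rw [Real.map_volume_mul_right hc]
  exact Measure.smul_absolutelyContinuous

theorem stmt3 (d : ℕ) (A : Matrix (Fin d) (Fin d) ℤ) (hA : A.det ≠ 0) (v : Fin d → ℚ)
    (hex : ∃ ω : ℝ,
      UDMod1 (fun n => ((A.map (Int.cast : ℤ → ℝ)) ^ n) *ᵥ (ω • fun i => ((v i : ℝ))))) :
    ∀ᵐ ω ∂(volume : Measure ℝ),
      UDMod1 (fun n => ((A.map (Int.cast : ℤ → ℝ)) ^ n) *ᵥ (ω • fun i => ((v i : ℝ)))) := by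
  obtain ⟨ω₀, hω₀⟩ := hex
  obtain ⟨q, hq, w, hw⟩ := exists_natCast_mul_eq_intCast v
  have hae : ∀ k : Fin d → ℤ, ∀ᵐ ω ∂(volume : Measure ℝ), k ≠ 0 → Tendsto
      (fun N : ℕ => ‖∑ n ∈ Finset.range N, unitExp (∑ i, (k i : ℝ) *
        (((A.map (Int.cast : ℤ → ℝ)) ^ n) *ᵥ (ω • fun i => ((v i : ℝ)))) i)‖ / (N : ℝ))
      atTop (nhds 0) := by
    intro k
    by_cases hk : k = 0
    · exact Eventually.of_forall fun _ h => absurd hk h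
    obtain ⟨C, hC⟩ := exists_card_fiber_le A hA k w fun M r hM => by
      obtain ⟨n, hn⟩ := exists_ne_of_tendsto_norm_sum_unitExp_div
        (t := fun n => ω₀ * (q : ℝ)⁻¹ * ((k ⬝ᵥ (A ^ n *ᵥ w) : ℤ) : ℝ)) (fun l hl => by
          refine (hω₀.tendsto_norm_sum_unitExp_div (smul_ne_zero hl hk)).congr fun N => ?_
          simp_rw [sum_mul_pow_mulVec_eq A _ w hw, smul_dotProduct, smul_eq_mul, Int.cast_mul,
            mul_left_comm]) hM r
      exact ⟨n, fun h => hn (by simp only [h])⟩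
    have hq' : (q : ℝ)⁻¹ ≠ 0 := inv_ne_zero (by exact_mod_cast hq.ne')
    filter_upwards [(quasiMeasurePreserving_mul_right hq').ae
      (ae_tendsto_norm_sum_unitExp_div hC)] with ω hω _
    simpa only [sum_mul_pow_mulVec_eq A _ w hw] using hω
  filter_upwards [ae_all_iff.2 hae] with ω hω
  exact UDMod1.of_tendsto_norm_sum_unitExp_div hω
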